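/- arXiv:1211.6631 — 2 statements merged into one kernel-verified Lean document; each statement's English description precedes it below -/
import Mathlib

section
/- Let M_i ≠ M_j be positive integers, let a_i, a_j > 0, θ_i, θ_j ∈ ℝ, and N₀_i, N₀_j > 0. Set A = {a_i·e^{iθ_i}·z : z ∈ S_P^{M_i}} and B = {a_j·e^{iθ_j}·z : z ∈ S_P^{M_j}}. Then klDiv(P_{A,N₀_i}, P_{B,N₀_j}) > 0. (Lemma 1, PSK-versus-PSK case: noncoherent Gaussian-mixture likelihoods of two PSK modulations of different orders are at positive KL distance for any values of the unknown amplitude, phase, and noise-power parameters.) -/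
open Real MeasureTheory ProbabilityTheory Filter

/-- The equal-weight homoscedastic complex Gaussian mixture density
`f_{S,N₀}(r) = (1/|S|) · Σ_{μ ∈ S} (1/(π N₀)) · exp(−|r − μ|²/N₀)`. -/
noncomputable def mixDensity (S : Finset ℂ) (N₀ : ℝ) (r : ℂ) : ℝ :=
  (S.card : ℝ)⁻¹ * ∑ μ ∈ S, (π * N₀)⁻¹ * Real.exp (-‖r - μ‖ ^ 2 / N₀)

/-- The probability measure `P_{S,N₀}` on `ℂ` with density `f_{S,N₀}` w.r.t. Lebesgue measure. -/
noncomputable def mixMeasure (S : Finset ℂ) (N₀ : ℝ) : Measure ℂ :=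
  volume.withDensity fun r => ENNReal.ofReal (mixDensity S N₀ r)

/-- Kullback–Leibler divergence `∫ log (dP/dQ) dP` of measures (`⊤` if `P` is not absolutely
continuous w.r.t. `Q` or the log-likelihood ratio is not integrable). -/
noncomputable def klDiv {α : Type*} [MeasurableSpace α] (P Q : Measure α) : EReal := by
  classical
  exact if P ≪ Q ∧ Integrable (llr P Q) P then ((∫ x, llr P Q x ∂P : ℝ) : EReal) else ⊤

/-- The `M`-PSK constellation `{exp(2πi·m/M) : m = 0,…,M−1} ⊆ ℂ`. -/
noncomputable def pskConstellation (M : ℕ) : Finset ℂ :=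
  (Finset.range M).image fun m : ℕ => Complex.exp (2 * (π : ℂ) * Complex.I * (m : ℂ) / (M : ℂ))

lemma gauss_integral (N : ℝ) (hN : 0 < N) (μ : ℂ) :
    ∫ r : ℂ, Real.exp (-‖r - μ‖ ^ 2 / N) = π * N := by
  rw [integral_sub_right_eq_self (fun r : ℂ => Real.exp (-‖r‖ ^ 2 / N)) μ]
  have h := GaussianFourier.integral_rexp_neg_mul_sq_norm (V := ℂ) (b := N⁻¹) (by positivity)
  rw [Complex.finrank_real_complex] at h
  norm_num at h
  rw [← h]
  congr 1; ext r; congr 1; ring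

lemma gauss_integrable (N : ℝ) (hN : 0 < N) (μ : ℂ) :
    Integrable (fun r : ℂ => Real.exp (-‖r - μ‖ ^ 2 / N)) := by
  by_contra h
  have h1 := gauss_integral N hN μ
  rw [integral_undef h] at h1
  have : 0 < π * N := by positivity
  linarith

lemma mixDensity_cont (S : Finset ℂ) (N : ℝ) : Continuous (mixDensity S N) := by
  unfold mixDensity
  fun_prop

lemma mixDensity_nonneg (S : Finset ℂ) (N : ℝ) (hN : 0 < N) (r : ℂ) : 0 ≤ mixDensity S N r := by
  unfold mixDensity
  positivity

lemma mixMeasure_prob (S : Finset ℂ) (hS : S.Nonempty) (N : ℝ) (hN : 0 < N) :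
    IsProbabilityMeasure (mixMeasure S N) := by
  constructor
  have hc : (0 : ℝ) < S.card := by exact_mod_cast hS.card_pos
  have hint : Integrable (mixDensity S N) := by
    unfold mixDensity
    exact (integrable_finsetSum _ fun μ _ => (gauss_integrable N hN μ).const_mul _).const_mul _
  rw [mixMeasure, withDensity_apply _ MeasurableSet.univ, Measure.restrict_univ,
    ← ofReal_integral_eq_lintegral_ofReal hint (ae_of_all _ (mixDensity_nonneg S N hN))]
  have : ∫ r, mixDensity S N r = 1 := by
    unfold mixDensity
    rw [integral_const_mul, integral_finsetSum _ fun μ _ => (gauss_integrable N hN μ).const_mul _]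
    simp_rw [integral_const_mul, gauss_integral N hN]
    have : π * N ≠ 0 := by positivity
    rw [inv_mul_cancel₀ this]
    simp
    exact inv_mul_cancel₀ hc.ne'
  rw [this]; simp

lemma density_eq (S T : Finset ℂ) (N N' : ℝ) (hN : 0 < N) (hN' : 0 < N') (hT : T.Nonempty)
    (h : mixMeasure S N = mixMeasure T N') : mixDensity S N = mixDensity T N' := by
  have := mixMeasure_prob T hT N' hN'
  have hm : ∀ S N, Measurable (fun r => ENNReal.ofReal (mixDensity S N r)) := fun S N =>
    (mixDensity_cont S N).measurable.ennreal_ofReal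
  unfold mixMeasure at h
  rw [withDensity_eq_iff_of_sigmaFinite (hm _ _).aemeasurable (hm _ _).aemeasurable] at h
  refine (Continuous.ae_eq_iff_eq volume (mixDensity_cont S N) (mixDensity_cont T N')).1 ?_
  filter_upwards [h] with r hr
  exact (ENNReal.ofReal_eq_ofReal_iff (mixDensity_nonneg S N hN r)
    (mixDensity_nonneg T N' hN' r)).1 hr

lemma mix_const (S : Finset ℂ) (hS : S.Nonempty) (c : ℝ) :
    (S.card : ℝ)⁻¹ * ∑ _μ ∈ S, c = c := by
  have hc : (S.card : ℝ) ≠ 0 := by exact_mod_cast hS.card_pos.ne'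
  simp; field_simp

lemma inv_le_of_eq (S T : Finset ℂ) (hS : S.Nonempty) (hT : T.Nonempty) (N N' : ℝ) (hN : 0 < N)
    (hN' : 0 < N') (h : mixDensity S N = mixDensity T N') : N'⁻¹ ≤ N⁻¹ := by
  obtain ⟨a, ha⟩ : ∃ a : ℝ, ∀ μ ∈ S ∪ T, ‖μ‖ ≤ a :=
    ⟨∑ μ ∈ S ∪ T, ‖μ‖, fun μ hμ => Finset.single_le_sum (f := fun μ : ℂ => ‖μ‖)
      (fun _ _ => norm_nonneg _) hμ⟩
  have key : ∀ x : ℝ, |a| ≤ x → (x - a) ^ 2 * N'⁻¹ ≤ (x + a) ^ 2 * N⁻¹ +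
      (Real.log (π * N) - Real.log (π * N')) := by
    intro x hx
    have hx0 : 0 ≤ x := (abs_nonneg a).trans hx
    have hxa : a ≤ x := (le_abs_self a).trans hx
    have hnx : ‖(x : ℂ)‖ = x := by simp [abs_of_nonneg hx0]
    have h1 : (π * N)⁻¹ * Real.exp (-(x + a) ^ 2 / N) ≤ mixDensity S N x := by
      rw [← mix_const S hS ((π * N)⁻¹ * Real.exp (-(x + a) ^ 2 / N))]
      unfold mixDensity
      gcongr with μ hμ
      have := norm_sub_le (x : ℂ) μ
      have := ha μ (Finset.mem_union_left _ hμ)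
      linarith
    have h2 : mixDensity T N' x ≤ (π * N')⁻¹ * Real.exp (-(x - a) ^ 2 / N') := by
      rw [← mix_const T hT ((π * N')⁻¹ * Real.exp (-(x - a) ^ 2 / N'))]
      unfold mixDensity
      gcongr with μ hμ
      have := norm_sub_norm_le (x : ℂ) μ
      have := ha μ (Finset.mem_union_right _ hμ)
      linarith
    rw [h] at h1
    have h3 := Real.log_le_log (by positivity) (h1.trans h2)
    rw [Real.log_mul (by positivity) (by positivity), Real.log_mul (by positivity) (by positivity),
      Real.log_exp, Real.log_exp, Real.log_inv, Real.log_inv] at h3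
    simp only [div_eq_mul_inv] at h3
    linarith
  by_contra! hlt
  set d := N'⁻¹ - N⁻¹ with hd
  have hd0 : 0 < d := by linarith
  set C := Real.log (π * N) - Real.log (π * N')
  set B := |2 * a * (N⁻¹ + N'⁻¹)| + |a ^ 2 * (N⁻¹ - N'⁻¹) + C| + d with hB
  have hBd : d ≤ B := by
    have := abs_nonneg (2 * a * (N⁻¹ + N'⁻¹))
    have := abs_nonneg (a ^ 2 * (N⁻¹ - N'⁻¹) + C)
    linarith
  have hBd1 : 1 ≤ B / d := by rw [le_div_iff₀ hd0]; linarith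
  set x := |a| + B / d with hx
  have hx1 : 1 ≤ x := by have := abs_nonneg a; linarith
  have hk := key x (by linarith)
  have e1 : B ≤ d * x := by
    have : d * (B / d) = B := by field_simp
    have := mul_nonneg hd0.le (abs_nonneg a)
    rw [hx, mul_add]; linarith
  have e2 : B * x ≤ d * x * x := by gcongr
  have e3 := le_abs_self (2 * a * (N⁻¹ + N'⁻¹))
  have e4 := le_abs_self (a ^ 2 * (N⁻¹ - N'⁻¹) + C)
  have e5 : 2 * a * (N⁻¹ + N'⁻¹) * x ≤ |2 * a * (N⁻¹ + N'⁻¹)| * x := by gcongr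
  have e6 : |a ^ 2 * (N⁻¹ - N'⁻¹) + C| * 1 ≤ |a ^ 2 * (N⁻¹ - N'⁻¹) + C| * x := by gcongr
  have e7 : 0 < d * x := by positivity
  have e8 : d * x * x = (N'⁻¹ - N⁻¹) * x * x := by rw [hd]
  have e9 : B * x = |2 * a * (N⁻¹ + N'⁻¹)| * x + |a ^ 2 * (N⁻¹ - N'⁻¹) + C| * x + d * x := by
    rw [hB]; ring
  nlinarith

noncomputable def expChar (N : ℝ) (μ : ℂ) : Multiplicative ℂ →* ℝ where
  toFun r := Real.exp (2 * inner ℝ (Multiplicative.toAdd r) μ / N)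
  map_one' := by simp
  map_mul' x y := by
    rw [← Real.exp_add, toAdd_mul, inner_add_left]; congr 1; ring

lemma expChar_inj (N : ℝ) (hN : 0 < N) : Function.Injective (expChar N) := by
  intro μ ν h
  refine ext_inner_left ℝ fun v => ?_
  have := DFunLike.congr_fun h (Multiplicative.ofAdd v)
  simp only [expChar, MonoidHom.coe_mk, OneHom.coe_mk, toAdd_ofAdd] at this
  have := Real.exp_injective this
  field_simp at this
  linarith

lemma mixDensity_expand (S : Finset ℂ) (N : ℝ) (r : ℂ) :
    mixDensity S N r = (π * N)⁻¹ * Real.exp (-‖r‖ ^ 2 / N) *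
      ∑ μ ∈ S, ((S.card : ℝ)⁻¹ * Real.exp (-‖μ‖ ^ 2 / N)) *
        expChar N μ (Multiplicative.ofAdd r) := by
  unfold mixDensity
  rw [Finset.mul_sum, Finset.mul_sum]
  refine Finset.sum_congr rfl fun μ _ => ?_
  have : Real.exp (-‖r - μ‖ ^ 2 / N) = Real.exp (-‖r‖ ^ 2 / N) * Real.exp (-‖μ‖ ^ 2 / N) *
      expChar N μ (Multiplicative.ofAdd r) := by
    simp only [expChar, MonoidHom.coe_mk, OneHom.coe_mk, toAdd_ofAdd]
    rw [← Real.exp_add, ← Real.exp_add, norm_sub_sq_real]; congr 1; ring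
  rw [this]; ring

lemma mix_subset_of_eq (S T : Finset ℂ) (N : ℝ) (hN : 0 < N)
    (h : mixDensity S N = mixDensity T N) : S ⊆ T := by
  classical
  intro ν hν
  by_contra hνT
  have li : LinearIndependent ℝ (fun μ : ℂ => (expChar N μ : Multiplicative ℂ → ℝ)) :=
    (linearIndependent_monoidHom (Multiplicative ℂ) ℝ).comp (expChar N) (expChar_inj N hN)
  rw [linearIndependent_iff'] at li
  let w : Finset ℂ → ℂ → ℝ := fun U μ =>
    if μ ∈ U then (U.card : ℝ)⁻¹ * Real.exp (-‖μ‖ ^ 2 / N) else 0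
  have hw : ∀ U ⊆ S ∪ T, ∀ r : ℂ, mixDensity U N r = (π * N)⁻¹ * Real.exp (-‖r‖ ^ 2 / N) *
      ∑ μ ∈ S ∪ T, w U μ * expChar N μ (Multiplicative.ofAdd r) := by
    intro U hU r
    rw [mixDensity_expand]
    congr 1
    rw [← Finset.sum_subset hU]
    · refine Finset.sum_congr rfl fun μ hμ => ?_
      simp [w, hμ]
    · intro μ _ hμ
      simp [w, hμ]
  have := li (S ∪ T) (fun μ => w S μ - w T μ) (by
    ext r
    have e := congrFun h (Multiplicative.toAdd r)
    rw [hw S Finset.subset_union_left, hw T Finset.subset_union_right] at e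
    have e2 := mul_left_cancel₀ (by positivity) e
    rw [ofAdd_toAdd] at e2
    simp only [Finset.sum_apply, Pi.smul_apply, smul_eq_mul, sub_mul, Finset.sum_sub_distrib,
      Pi.zero_apply]
    linarith) ν (Finset.mem_union_left _ hν)
  have hc : (0 : ℝ) < S.card := by exact_mod_cast Finset.card_pos.2 ⟨ν, hν⟩
  simp only [w, hν, hνT, if_true, if_false, sub_zero] at this
  have h0 : 0 < (S.card : ℝ)⁻¹ * Real.exp (-‖ν‖ ^ 2 / N) := by positivity
  linarith

lemma eq_of_mix (S T : Finset ℂ) (hS : S.Nonempty) (hT : T.Nonempty) (N N' : ℝ) (hN : 0 < N)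
    (hN' : 0 < N') (h : mixMeasure S N = mixMeasure T N') : S = T := by
  have hd := density_eq S T N N' hN hN' hT h
  have hNN : N = N' := inv_injective
    (le_antisymm (inv_le_of_eq T S hT hS N' N hN' hN hd.symm) (inv_le_of_eq S T hS hT N N' hN hN' hd))
  subst hNN
  exact (mix_subset_of_eq S T N hN hd).antisymm (mix_subset_of_eq T S N hN hd.symm)

lemma psk_card (M : ℕ) (hM : 1 ≤ M) : (pskConstellation M).card = M := by
  unfold pskConstellation
  rw [Finset.card_image_of_injOn, Finset.card_range]
  have hp := Complex.isPrimitiveRoot_exp M (by omega)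
  intro i hi j hj hij
  refine hp.pow_inj (Finset.mem_range.1 hi) (Finset.mem_range.1 hj) ?_
  rw [← Complex.exp_nat_mul, ← Complex.exp_nat_mul]
  convert hij using 2 <;> ring

lemma psk_image_card (M : ℕ) (hM : 1 ≤ M) (a θ : ℝ) (ha : 0 < a) :
    ((pskConstellation M).image
      fun z => (a : ℂ) * Complex.exp (Complex.I * (θ : ℂ)) * z).card = M := by
  rw [Finset.card_image_of_injective, psk_card M hM]
  exact mul_right_injective₀ (mul_ne_zero (by exact_mod_cast ha.ne') (Complex.exp_ne_zero _))

lemma klDiv_pos_of_ne {α : Type*} [MeasurableSpace α] (P Q : Measure α)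
    [IsProbabilityMeasure P] [IsProbabilityMeasure Q] (h : P ≠ Q) : 0 < klDiv P Q := by
  unfold klDiv
  split_ifs with hc
  · rw [← InformationTheory.toReal_klDiv_of_measure_eq hc.1 (by simp)]
    have h1 := InformationTheory.klDiv_ne_top hc.1 hc.2
    have h2 : InformationTheory.klDiv P Q ≠ 0 := fun h0 =>
      h (InformationTheory.klDiv_eq_zero_iff.1 h0)
    exact_mod_cast ENNReal.toReal_pos h2 h1
  · exact EReal.coe_lt_top 0

/-- **Lemma 1, PSK-vs-PSK case.** The noncoherent Gaussian-mixture likelihoods of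
two PSK modulations of different orders are at positive KL distance for all parameter values. -/
theorem klDiv_psk_psk_pos (Mi Mj : ℕ) (hMi : 1 ≤ Mi) (hMj : 1 ≤ Mj) (hne : Mi ≠ Mj)
    (ai aj : ℝ) (hai : 0 < ai) (haj : 0 < aj) (θi θj : ℝ)
    (N₀i N₀j : ℝ) (hN₀i : 0 < N₀i) (hN₀j : 0 < N₀j) :
    0 < klDiv
      (mixMeasure ((pskConstellation Mi).image
        fun z => (ai : ℂ) * Complex.exp (Complex.I * (θi : ℂ)) * z) N₀i)
      (mixMeasure ((pskConstellation Mj).image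
        fun z => (aj : ℂ) * Complex.exp (Complex.I * (θj : ℂ)) * z) N₀j) := by
  have ci := psk_image_card Mi hMi ai θi hai
  have cj := psk_image_card Mj hMj aj θj haj
  have ni := Finset.card_pos.1 (ci.symm ▸ hMi : 0 < Finset.card _)
  have nj := Finset.card_pos.1 (cj.symm ▸ hMj : 0 < Finset.card _)
  have := mixMeasure_prob _ ni N₀i hN₀i
  have := mixMeasure_prob _ nj N₀j hN₀j
  refine klDiv_pos_of_ne _ _ fun he => hne ?_
  have := eq_of_mix _ _ ni nj _ _ hN₀i hN₀j he
  rw [this] at ci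
  exact ci.symm.trans cj
end

section
/- Fix an integer N ≥ 2 and reals Γ > 0, N₀ > 0, and let M_1,…,M_K be pairwise distinct PSK orders, each a power of 2. For each j, let Q_{M_j} be the probability measure on ℂ^N whose density with respect to Lebesgue measure is (πN₀)^{−N}·g_{M_j}. Fix i ∈ {1,…,K} and let (r_l)_{l≥1} be an i.i.d. sequence of ℂ^N-valued random variables with law Q_{M_i}. Then lim_{L→∞} ℙ( there exists j ≠ i with Σ_{l=1}^{L} log g_{M_j}(r_l) ≥ Σ_{l=1}^{L} log g_{M_i}(r_l) ) = 0. (Theorem 4: with known noise power N₀, Rayleigh-distributed amplitude, and uniformly distributed phase, the ALRT-based fused ML classifier achieves zero probability of error as the number of sensors L → ∞, for any fixed number N of observations per sensor.) -/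
open Real MeasureTheory ProbabilityTheory Filter

/-- Sum of pairwise cosines `Σ_{k<h} cos(2π(m_h − m_k)/M)` of a symbol index sequence. -/
noncomputable def pairCosSum (M N : ℕ) (m : Fin N → Fin M) : ℝ :=
  ∑ p ∈ Finset.univ.filter (fun p : Fin N × Fin N => p.1 < p.2),
    Real.cos (2 * π * (((m p.2 : ℕ) : ℝ) - ((m p.1 : ℕ) : ℝ)) / (M : ℝ))

/-- The ALRT averaged likelihood (up to the constant `(πN₀)^{−N}`) of `N` samples of `M`-PSK
under Rayleigh amplitude with `E[a²] = Γ`, uniform phase, and known noise power `N₀`. -/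
noncomputable def alrtLik (Γ N₀ : ℝ) (N M : ℕ) (r : Fin N → ℂ) : ℝ :=
  ((M : ℝ) ^ N)⁻¹ * ∑ m : Fin N → Fin M, (1 + N * Γ / N₀)⁻¹ *
    Real.exp ((Γ / N₀ ^ 2) *
        (‖∑ k, Complex.exp
            (-(2 * (π : ℂ) * Complex.I * ((m k : ℕ) : ℂ) / (M : ℂ))) * r k‖) ^ 2
          / (1 + N * Γ / N₀)
      - (∑ k, (‖r k‖) ^ 2) / N₀)

/-- The probability measure on `ℂ^N` whose density w.r.t. Lebesgue measure is
`(πN₀)^{−N} · alrtLik Γ N₀ N M`. -/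
noncomputable def alrtMeasure (Γ N₀ : ℝ) (N M : ℕ) : Measure (Fin N → ℂ) :=
  volume.withDensity fun r => ENNReal.ofReal (((π * N₀) ^ N)⁻¹ * alrtLik Γ N₀ N M r)

lemma aux_continuous (Γ N₀ : ℝ) (N M : ℕ) : Continuous (alrtLik Γ N₀ N M) := by
  unfold alrtLik
  fun_prop

lemma aux_pos (Γ N₀ : ℝ) (hΓ : 0 < Γ) (hN₀ : 0 < N₀) (N M : ℕ) (hM : 0 < M) (r : Fin N → ℂ) :
    0 < alrtLik Γ N₀ N M r := by
  unfold alrtLik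
  have : NeZero M := ⟨hM.ne'⟩
  have h1 : 0 < (M : ℝ) := by exact_mod_cast hM
  have h2 : 0 < 1 + N * Γ / N₀ := by positivity
  refine mul_pos (by positivity) (Finset.sum_pos (fun m _ => by positivity) ?_)
  exact Finset.univ_nonempty

lemma aux_norm (M a : ℕ) :
    ‖Complex.exp (-(2 * (π : ℂ) * Complex.I * (a : ℂ) / (M : ℂ)))‖ = 1 := by
  have : (-(2 * (π : ℂ) * Complex.I * (a : ℂ) / (M : ℂ)))
      = ((-(2 * π * a / M) : ℝ) : ℂ) * Complex.I := by
    push_cast; ring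
  rw [this, Complex.norm_exp_ofReal_mul_I]

/-- The rotation-invariant reference value of the mass. -/
noncomputable def auxMass (Γ N₀ : ℝ) (N : ℕ) : ENNReal :=
  ∫⁻ r : Fin N → ℂ, ENNReal.ofReal ((1 + N * Γ / N₀)⁻¹ *
    Real.exp ((Γ / N₀ ^ 2) * (‖∑ k, r k‖) ^ 2 / (1 + N * Γ / N₀) - (∑ k, (‖r k‖) ^ 2) / N₀))

lemma aux_rot (Γ N₀ : ℝ) (N : ℕ) (c : Fin N → ℂ) (hc : ∀ k, ‖c k‖ = 1) :
    ∫⁻ r : Fin N → ℂ, ENNReal.ofReal ((1 + N * Γ / N₀)⁻¹ *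
      Real.exp ((Γ / N₀ ^ 2) * (‖∑ k, c k * r k‖) ^ 2 / (1 + N * Γ / N₀)
        - (∑ k, (‖r k‖) ^ 2) / N₀)) = auxMass Γ N₀ N := by
  have hmp : MeasurePreserving (fun (r : Fin N → ℂ) (k : Fin N) => c k * r k) := by
    refine volume_preserving_pi (f := fun k z => c k * z) fun k => ?_
    have := (rotation (⟨c k, mem_sphere_zero_iff_norm.2 (hc k)⟩ : Circle)).measurePreserving
    exact this
  unfold auxMass
  rw [← hmp.lintegral_comp (f := fun r : Fin N → ℂ => ENNReal.ofReal ((1 + N * Γ / N₀)⁻¹ *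
    Real.exp ((Γ / N₀ ^ 2) * (‖∑ k, r k‖) ^ 2 / (1 + N * Γ / N₀) - (∑ k, (‖r k‖) ^ 2) / N₀)))
    (by fun_prop)]
  refine lintegral_congr fun r => ?_
  simp [hc]

lemma aux_mass (Γ N₀ : ℝ) (hΓ : 0 < Γ) (hN₀ : 0 < N₀) (N M : ℕ) (hM : 0 < M) :
    ∫⁻ r, ENNReal.ofReal (alrtLik Γ N₀ N M r) = auxMass Γ N₀ N := by
  have h1 : 0 < (M : ℝ) := by exact_mod_cast hM
  have h2 : 0 < 1 + N * Γ / N₀ := by positivity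
  unfold alrtLik
  simp_rw [ENNReal.ofReal_mul (inv_nonneg.2 (pow_nonneg h1.le N))]
  rw [lintegral_const_mul _ (by fun_prop)]
  have h3 : ∀ r : Fin N → ℂ, ENNReal.ofReal (∑ m : Fin N → Fin M, (1 + N * Γ / N₀)⁻¹ *
    Real.exp ((Γ / N₀ ^ 2) *
        (‖∑ k, Complex.exp
            (-(2 * (π : ℂ) * Complex.I * ((m k : ℕ) : ℂ) / (M : ℂ))) * r k‖) ^ 2
          / (1 + N * Γ / N₀)
      - (∑ k, (‖r k‖) ^ 2) / N₀)) = ∑ m : Fin N → Fin M, ENNReal.ofReal ((1 + N * Γ / N₀)⁻¹ *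
    Real.exp ((Γ / N₀ ^ 2) *
        (‖∑ k, Complex.exp
            (-(2 * (π : ℂ) * Complex.I * ((m k : ℕ) : ℂ) / (M : ℂ))) * r k‖) ^ 2
          / (1 + N * Γ / N₀)
      - (∑ k, (‖r k‖) ^ 2) / N₀)) := fun r =>
    ENNReal.ofReal_sum_of_nonneg fun m _ => by positivity
  simp_rw [h3]
  rw [lintegral_finsetSum _ (fun m _ => by fun_prop)]
  have h4 := fun m : Fin N → Fin M => aux_rot Γ N₀ N
    (fun k => Complex.exp (-(2 * (π : ℂ) * Complex.I * ((m k : ℕ) : ℂ) / (M : ℂ))))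
    (fun k => aux_norm M (m k))
  simp_rw [h4]
  simp only [Finset.sum_const, Finset.card_univ, Fintype.card_fun, Fintype.card_fin, nsmul_eq_mul]
  rw [← mul_assoc, ENNReal.ofReal_inv_of_pos (by positivity),
    show ((M ^ N : ℕ) : ENNReal) = ENNReal.ofReal ((M : ℝ) ^ N) by
      rw [← ENNReal.ofReal_natCast]; push_cast; rfl,
    ENNReal.inv_mul_cancel, one_mul]
  · exact (ENNReal.ofReal_pos.2 (by positivity)).ne'
  · exact ENNReal.ofReal_ne_top

/-- Vector with entries `1` and `w` at two places, scaled by `t`. -/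
noncomputable def auxVec (N : ℕ) (p q : Fin N) (w : ℂ) (t : ℝ) : Fin N → ℂ :=
  fun k => (t : ℂ) * ((Pi.single p 1 : Fin N → ℂ) k + (Pi.single q w : Fin N → ℂ) k)

lemma auxVec_sum (N : ℕ) (p q : Fin N) (w : ℂ) (t : ℝ) (c : Fin N → ℂ) :
    ‖∑ k, c k * auxVec N p q w t k‖ ^ 2 = t ^ 2 * ‖c p + c q * w‖ ^ 2 := by
  have : ∑ k, c k * auxVec N p q w t k = t * (c p + c q * w) := by
    simp only [auxVec, Pi.single_apply]
    simp [mul_add, Finset.sum_add_distrib, mul_left_comm]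
    ring
  rw [this, norm_mul, mul_pow]
  simp

lemma aux_sep (Γ N₀ : ℝ) (hΓ : 0 < Γ) (hN₀ : 0 < N₀) (N M M' : ℕ) (hN : 2 ≤ N) (hM : 0 < M)
    (hMM : M < M') : ∃ r, alrtLik Γ N₀ N M r ≠ alrtLik Γ N₀ N M' r := by
  by_contra! hcon
  let p : Fin N := ⟨0, by omega⟩
  let q : Fin N := ⟨1, by omega⟩
  have hpq : p ≠ q := by simp [p, q]
  let w : ℂ := Complex.exp (2 * (π : ℂ) * Complex.I / (M' : ℂ))
  have hw : ‖w‖ = 1 := by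
    have : (2 * (π : ℂ) * Complex.I / (M' : ℂ)) = ((2 * π / M' : ℝ) : ℂ) * Complex.I := by
      push_cast; ring
    simp only [w]
    rw [this, Complex.norm_exp_ofReal_mul_I]
  have h1 : 0 < (M : ℝ) := by exact_mod_cast hM
  have h1' : 0 < (M' : ℝ) := by exact_mod_cast hM.trans hMM
  have hb : 0 < 1 + N * Γ / N₀ := by positivity
  let e : ∀ M : ℕ, Fin M → ℂ := fun M a =>
    Complex.exp (-(2 * (π : ℂ) * Complex.I * ((a : ℕ) : ℂ) / (M : ℂ)))
  let κ : ℝ := Γ / N₀ ^ 2 / (1 + N * Γ / N₀)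
  have hκ : 0 < κ := by positivity
  -- strictness
  have hlt : ∀ a b : Fin M, ‖e M a + e M b * w‖ < 2 := by
    intro a b
    have ha : ‖e M a‖ = 1 := aux_norm M a
    have hb : ‖e M b * w‖ = 1 := by rw [norm_mul, hw, mul_one]; exact aux_norm M b
    refine lt_of_le_of_ne ((norm_add_le _ _).trans (by rw [ha, hb]; norm_num)) fun h => ?_
    have heq := eq_of_norm_eq_of_norm_add_eq (ha.trans hb.symm) (by rw [h, ha, hb]; norm_num)
    have hMc : (M : ℂ) ≠ 0 := by exact_mod_cast hM.ne'
    have hMc' : (M' : ℂ) ≠ 0 := by exact_mod_cast (hM.trans hMM).ne'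
    have hpw : ∀ a : Fin M, (e M a) ^ M = 1 := by
      intro a
      simp only [e]
      rw [← Complex.exp_nat_mul, Complex.exp_eq_one_iff]
      refine ⟨-(a : ℕ), ?_⟩
      push_cast
      field_simp
    have h2 : w ^ M = 1 := by
      have := congrArg (· ^ M) heq
      simpa [mul_pow, hpw] using this.symm
    simp only [w] at h2
    rw [← Complex.exp_nat_mul, Complex.exp_eq_one_iff] at h2
    obtain ⟨n, hn⟩ := h2
    have h3 : (M : ℂ) = n * M' := by
      have hpi : (2 * (π : ℂ) * Complex.I) ≠ 0 := Complex.two_pi_I_ne_zero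
      field_simp at hn
      rw [hn]; ring
    have h4 : (M : ℤ) = n * M' := by exact_mod_cast h3
    have h5 : (M' : ℤ) ∣ M := ⟨n, by rw [h4]; ring⟩
    have h6 := Nat.le_of_dvd hM (by exact_mod_cast h5)
    omega
  -- comparison
  have key : ∀ t : ℝ, ((M' : ℝ) ^ N)⁻¹ ≤ ((M : ℝ) ^ N)⁻¹ * ∑ m : Fin N → Fin M,
      Real.exp (-(κ * (4 - ‖e M (m p) + e M (m q) * w‖ ^ 2)) * t ^ 2) := by
    intro t
    have hc := hcon (auxVec N p q w t)
    unfold alrtLik at hc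
    have hs := fun (M : ℕ) (m : Fin N → Fin M) => auxVec_sum N p q w t (fun k => e M (m k))
    simp only [e] at hs
    simp only [hs] at hc
    set V := (∑ k, ‖auxVec N p q w t k‖ ^ 2) / N₀ with hV
    let m₀ : Fin N → Fin M' := fun k => if k = q then ⟨1, by omega⟩ else ⟨0, by omega⟩
    have hm₀ : ‖e M' (m₀ p) + e M' (m₀ q) * w‖ ^ 2 = 4 := by
      have : e M' (m₀ p) + e M' (m₀ q) * w = 2 := by
        simp only [e, w, m₀, hpq, if_true, if_false]
        rw [← Complex.exp_add]
        simp
        norm_num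
      rw [this]; norm_num
    have hge := Finset.single_le_sum (f := fun m : Fin N → Fin M' => (1 + N * Γ / N₀)⁻¹ *
      Real.exp (Γ / N₀ ^ 2 * (t ^ 2 * ‖e M' (m p) + e M' (m q) * w‖ ^ 2) / (1 + N * Γ / N₀) - V))
      (fun m _ => by positivity) (Finset.mem_univ m₀)
    have hge2 := mul_le_mul_of_nonneg_left hge (a := ((M' : ℝ) ^ N)⁻¹) (by positivity)
    simp only [e] at hge2 hm₀
    rw [← hc] at hge2
    simp only [hm₀] at hge2
    have hmul := mul_le_mul_of_nonneg_right hge2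
      (show 0 ≤ (1 + N * Γ / N₀) * Real.exp (V - κ * 4 * t ^ 2) by positivity)
    refine le_trans (le_of_eq ?_) (hmul.trans (le_of_eq ?_))
    · rw [show (((M' : ℝ) ^ N)⁻¹ * ((1 + N * Γ / N₀)⁻¹ * rexp (Γ / N₀ ^ 2 * (t ^ 2 * 4) / (1 + N * Γ / N₀) - V)) *
        ((1 + N * Γ / N₀) * rexp (V - κ * 4 * t ^ 2))) = ((M' : ℝ) ^ N)⁻¹ * ((1 + N * Γ / N₀)⁻¹ * (1 + N * Γ / N₀)) *
        (rexp (Γ / N₀ ^ 2 * (t ^ 2 * 4) / (1 + N * Γ / N₀) - V) * rexp (V - κ * 4 * t ^ 2)) by ring,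
        inv_mul_cancel₀ hb.ne', ← Real.exp_add,
        show (Γ / N₀ ^ 2 * (t ^ 2 * 4) / (1 + N * Γ / N₀) - V) + (V - κ * 4 * t ^ 2) = 0 by
          simp only [κ]; ring]
      simp
    · rw [mul_assoc, Finset.sum_mul]
      congr 1
      refine Finset.sum_congr rfl fun m _ => ?_
      rw [mul_mul_mul_comm, inv_mul_cancel₀ hb.ne', ← Real.exp_add, one_mul]
      congr 1
      simp only [κ, e]; ring
  have hlim : Tendsto (fun t : ℝ => ((M : ℝ) ^ N)⁻¹ * ∑ m : Fin N → Fin M,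
      Real.exp (-(κ * (4 - ‖e M (m p) + e M (m q) * w‖ ^ 2)) * t ^ 2)) atTop
      (nhds (((M : ℝ) ^ N)⁻¹ * ∑ m : Fin N → Fin M, 0)) := by
    refine Tendsto.const_mul _ (tendsto_finsetSum _ fun m _ => ?_)
    refine Real.tendsto_exp_atBot.comp ?_
    have hpos : 0 < κ * (4 - ‖e M (m p) + e M (m q) * w‖ ^ 2) := by
      refine mul_pos hκ ?_
      nlinarith [hlt (m p) (m q), norm_nonneg (e M (m p) + e M (m q) * w)]
    exact (tendsto_pow_atTop (by norm_num)).const_mul_atTop_of_neg (neg_neg_of_pos hpos)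
  have := ge_of_tendsto' hlim key
  simp only [Finset.sum_const_zero, mul_zero] at this
  have h7 : 0 < ((M' : ℝ) ^ N)⁻¹ := by positivity
  linarith

lemma aux_amgm (a b : ℝ) (ha : 0 < a) (hb : 0 < b) :
    a * Real.exp ((Real.log b - Real.log a) / 2) ≤ (a + b) / 2 ∧
    (a ≠ b → a * Real.exp ((Real.log b - Real.log a) / 2) < (a + b) / 2) := by
  set x := Real.exp (Real.log a / 2) with hx
  set y := Real.exp (Real.log b / 2) with hy
  have hxa : a = x * x := by rw [hx, ← Real.exp_add, add_halves, Real.exp_log ha]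
  have hyb : b = y * y := by rw [hy, ← Real.exp_add, add_halves, Real.exp_log hb]
  have hx0 : 0 < x := Real.exp_pos _
  have he : a * Real.exp ((Real.log b - Real.log a) / 2) = x * y := by
    rw [sub_div, Real.exp_sub, ← hx, ← hy]
    nth_rewrite 1 [hxa]
    field_simp
  rw [he]
  constructor
  · nlinarith [sq_nonneg (x - y)]
  · intro hne
    have : x - y ≠ 0 := fun h => hne (by rw [hxa, hyb, sub_eq_zero.1 h])
    have := sq_pos_of_ne_zero this
    nlinarith

lemma aux_rho (Γ N₀ : ℝ) (hΓ : 0 < Γ) (hN₀ : 0 < N₀) (N M M' : ℕ) (hN : 2 ≤ N) (hM : 0 < M)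
    (hM' : 0 < M') (hMM : M ≠ M') [IsProbabilityMeasure (alrtMeasure Γ N₀ N M)] :
    ∫⁻ r, ENNReal.ofReal (Real.exp ((Real.log (alrtLik Γ N₀ N M' r)
      - Real.log (alrtLik Γ N₀ N M r)) / 2)) ∂(alrtMeasure Γ N₀ N M) < 1 := by
  have hc : 0 < ((π * N₀) ^ N)⁻¹ := by have := Real.pi_pos; positivity
  have c1 := aux_continuous Γ N₀ N M
  have c2 := aux_continuous Γ N₀ N M'
  have p1 := aux_pos Γ N₀ hΓ hN₀ N M hM
  have p2 := aux_pos Γ N₀ hΓ hN₀ N M' hM'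
  set f := alrtLik Γ N₀ N M with hf
  set g := alrtLik Γ N₀ N M' with hg
  set c := ((π * N₀) ^ N)⁻¹ with hcdef
  have hone : ∫⁻ r, ENNReal.ofReal (c * f r) = 1 := by
    have := measure_univ (μ := alrtMeasure Γ N₀ N M)
    unfold alrtMeasure at this
    rwa [withDensity_apply _ MeasurableSet.univ, Measure.restrict_univ] at this
  have hone' : ∫⁻ r, ENNReal.ofReal (c * g r) = 1 := by
    rw [← hone]
    simp_rw [ENNReal.ofReal_mul hc.le]
    rw [lintegral_const_mul _ (by fun_prop), lintegral_const_mul _ (by fun_prop), hf, hg,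
      aux_mass Γ N₀ hΓ hN₀ N M hM, aux_mass Γ N₀ hΓ hN₀ N M' hM']
  have hmf : Measurable f := c1.measurable
  have hmg : Measurable g := c2.measurable
  have hmid : ∫⁻ r, ENNReal.ofReal (c * ((f r + g r) / 2)) = 1 := by
    have : ∀ r, ENNReal.ofReal (c * ((f r + g r) / 2)) =
        ENNReal.ofReal (1 / 2) * (ENNReal.ofReal (c * f r) + ENNReal.ofReal (c * g r)) := by
      intro r
      rw [← ENNReal.ofReal_add (mul_pos hc (p1 r)).le (mul_pos hc (p2 r)).le,
        ← ENNReal.ofReal_mul (by norm_num)]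
      congr 1; ring
    simp_rw [this]
    rw [lintegral_const_mul _ (by fun_prop), lintegral_add_left (by fun_prop), hone, hone',
      show (1 : ENNReal) + 1 = ENNReal.ofReal 2 by norm_num,
      ← ENNReal.ofReal_mul (by norm_num)]
    norm_num
  have hle : ∀ r, ENNReal.ofReal (c * (f r * Real.exp ((Real.log (g r) - Real.log (f r)) / 2)))
      ≤ ENNReal.ofReal (c * ((f r + g r) / 2)) := fun r =>
    ENNReal.ofReal_le_ofReal (mul_le_mul_of_nonneg_left (aux_amgm _ _ (p1 r) (p2 r)).1 hc.le)
  have hsep : ∃ r, f r ≠ g r := by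
    rcases lt_or_gt_of_ne hMM with h | h
    · exact aux_sep Γ N₀ hΓ hN₀ N M M' hN hM h
    · obtain ⟨r, hr⟩ := aux_sep Γ N₀ hΓ hN₀ N M' M hN hM' h
      exact ⟨r, hr.symm⟩
  have hopen : IsOpen {r | f r ≠ g r} := isOpen_ne_fun c1 c2
  unfold alrtMeasure
  rw [← hf, ← hcdef, lintegral_withDensity_eq_lintegral_mul _ (by fun_prop) (by fun_prop)]
  have heq : ∀ r, ((fun r => ENNReal.ofReal (c * f r)) * (fun r => ENNReal.ofReal
      (Real.exp ((Real.log (g r) - Real.log (f r)) / 2)))) r =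
      ENNReal.ofReal (c * (f r * Real.exp ((Real.log (g r) - Real.log (f r)) / 2))) := by
    intro r
    simp only [Pi.mul_apply]
    rw [← ENNReal.ofReal_mul (mul_pos hc (p1 r)).le, mul_assoc]
  rw [lintegral_congr heq, ← hmid]
  refine lintegral_strict_mono_of_ae_le_of_ae_lt_on (by fun_prop) ?_ (ae_of_all _ hle)
    (hopen.measure_pos volume hsep).ne' (ae_of_all _ fun r hr => ?_)
  · exact ((lintegral_mono hle).trans_lt (by rw [hmid]; exact ENNReal.one_lt_top)).ne
  · refine (ENNReal.ofReal_lt_ofReal_iff ?_).2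
      (mul_lt_mul_of_pos_left ((aux_amgm _ _ (p1 r) (p2 r)).2 hr) hc)
    exact mul_pos hc (by linarith [p1 r, p2 r])

/-- **Theorem 4.** With known noise power, Rayleigh amplitude and uniform phase,
the ALRT-based fused ML classifier achieves vanishing error probability as the number of
sensors `L → ∞`, for any fixed number `N ≥ 2` of observations per sensor. -/
theorem alrt_fused_error_tendsto_zero {Ω : Type*} [MeasureSpace Ω]
    [IsProbabilityMeasure (ℙ : Measure Ω)]
    (N : ℕ) (hN : 2 ≤ N) (Γ N₀ : ℝ) (hΓ : 0 < Γ) (hN₀ : 0 < N₀)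
    (K : ℕ) (M : Fin K → ℕ) (hpow : ∀ j, ∃ k : ℕ, M j = 2 ^ k)
    (hdist : Function.Injective M) (i : Fin K)
    (r : ℕ → Ω → (Fin N → ℂ)) (hmeas : ∀ l, Measurable (r l))
    (hindep : iIndepFun (m := fun _ => inferInstance) r ℙ)
    (hlaw : ∀ l, Measure.map (r l) ℙ = alrtMeasure Γ N₀ N (M i)) :
    Tendsto
      (fun L : ℕ => (ℙ : Measure Ω) {ω | ∃ j ≠ i,
        ∑ l ∈ Finset.range L, Real.log (alrtLik Γ N₀ N (M i) (r l ω)) ≤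
          ∑ l ∈ Finset.range L, Real.log (alrtLik Γ N₀ N (M j) (r l ω))})
      atTop (nhds 0) := by
  have hMpos : ∀ j, 0 < M j := fun j => by
    obtain ⟨k, hk⟩ := hpow j
    rw [hk]; positivity
  have : IsProbabilityMeasure (alrtMeasure Γ N₀ N (M i)) := by
    rw [← hlaw 0]
    exact Measure.isProbabilityMeasure_map (hmeas 0).aemeasurable
  let h : Fin K → (Fin N → ℂ) → ENNReal := fun j x =>
    ENNReal.ofReal (Real.exp ((Real.log (alrtLik Γ N₀ N (M j) x)
      - Real.log (alrtLik Γ N₀ N (M i) x)) / 2))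
  have hh : ∀ j, Measurable (h j) := fun j => by
    have m1 := (aux_continuous Γ N₀ N (M i)).measurable
    have m2 := (aux_continuous Γ N₀ N (M j)).measurable
    simp only [h]
    fun_prop
  let ρ : Fin K → ENNReal := fun j => ∫⁻ x, h j x ∂(alrtMeasure Γ N₀ N (M i))
  have hρ : ∀ j, j ≠ i → ρ j < 1 := fun j hj =>
    aux_rho Γ N₀ hΓ hN₀ N (M i) (M j) hN (hMpos i) (hMpos j) fun e => hj (hdist e).symm
  have hbound : ∀ (L : ℕ) (j : Fin K), (ℙ : Measure Ω) {ω |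
        ∑ l ∈ Finset.range L, Real.log (alrtLik Γ N₀ N (M i) (r l ω)) ≤
          ∑ l ∈ Finset.range L, Real.log (alrtLik Γ N₀ N (M j) (r l ω))} ≤ ρ j ^ L := by
    intro L j
    have hind : iIndepFun (fun l ω => h j (r l ω)) ℙ :=
      hindep.comp (fun _ => h j) (fun _ => hh j)
    have hprod := lintegral_prod_eq_prod_lintegral_of_indepFun (Finset.range L)
      (fun l ω => h j (r l ω)) hind (fun l => (hh j).comp (hmeas l))
    have hone : ∀ l, ∫⁻ ω, h j (r l ω) ∂ℙ = ρ j := fun l => by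
      simp only [ρ]
      rw [← hlaw l, lintegral_map (hh j) (hmeas l)]
    simp only [hone, Finset.prod_const, Finset.card_range] at hprod
    have hm := mul_meas_ge_le_lintegral (μ := (ℙ : Measure Ω))
      (f := fun ω => ∏ l ∈ Finset.range L, h j (r l ω))
      (Finset.measurable_fun_prod _ fun l _ => (hh j).comp (hmeas l)) 1
    rw [one_mul] at hm
    rw [← hprod]
    refine le_trans (measure_mono fun ω hω => ?_) hm
    simp only [Set.mem_ofPred_eq] at hω ⊢
    simp only [h]
    rw [← ENNReal.ofReal_prod_of_nonneg (fun l _ => (Real.exp_pos _).le), ← Real.exp_sum,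
      ← ENNReal.ofReal_one]
    refine ENNReal.ofReal_le_ofReal (Real.one_le_exp ?_)
    rw [← Finset.sum_div, Finset.sum_sub_distrib]
    linarith
  have hlim : Tendsto (fun L : ℕ => ∑ j ∈ Finset.univ.filter (fun j => j ≠ i), ρ j ^ L) atTop
      (nhds (∑ j ∈ Finset.univ.filter (fun j => j ≠ i), 0)) :=
    tendsto_finsetSum _ fun j hj =>
      ENNReal.tendsto_pow_atTop_nhds_zero_of_lt_one (hρ j (Finset.mem_filter.1 hj).2)
  rw [Finset.sum_const_zero] at hlim
  refine tendsto_of_tendsto_of_tendsto_of_le_of_le tendsto_const_nhds hlim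
    (fun L => zero_le) fun L => ?_
  refine le_trans (measure_mono (t := ⋃ j ∈ Finset.univ.filter (fun j => j ≠ i), {ω |
        ∑ l ∈ Finset.range L, Real.log (alrtLik Γ N₀ N (M i) (r l ω)) ≤
          ∑ l ∈ Finset.range L, Real.log (alrtLik Γ N₀ N (M j) (r l ω))}) ?_)
    ((measure_biUnion_finset_le _ _).trans (Finset.sum_le_sum fun j _ => hbound L j))
  rintro ω ⟨j, hj, hω⟩
  simp only [Set.mem_iUnion]
  exact ⟨j, by simpa using hj, hω⟩
end
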